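/- Let β ∈ ℝ and τ ∈ ℂ with Im τ > 0, and define f(z) = e^{(ν/2)z²} θ_{α,β}(z|τ). Then ∫_S |f(z)|² e^{−ν|z|²} dm(z) = (π/(2ν))^{1/2} Σ_{n∈ℤ} e^{−2π(n+α)²(Im τ − π/ν)}, as an identity in [0,∞]; in particular this integral is finite if and only if Im τ > π/ν. -/

import Mathlib

open Complex MeasureTheory ENNReal

/-- The Riemann theta function with characteristic `[α, β]`:
`θ_{α,β}(z|τ) = Σ_{n∈ℤ} e^{πi(n+α)²τ + 2πi(n+α)(z+β)}`. -/
noncomputable def riemannTheta (α β : ℝ) (z τ : ℂ) : ℂ :=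
  ∑' n : ℤ, Complex.exp (Real.pi * Complex.I * ((n : ℂ) + α) ^ 2 * τ +
    2 * Real.pi * Complex.I * ((n : ℂ) + α) * (z + β))

/-- **Parseval's identity** for an absolutely convergent Fourier series on the unit interval. -/
theorem lintegral_enorm_sq_tsum_fourier {c : ℤ → ℂ} (hc : Summable c) :
    ∫⁻ x in Set.Icc (0 : ℝ) 1, ‖∑' n : ℤ, c n * cexp (2 * Real.pi * I * n * x)‖ₑ ^ 2 =
      ∑' n : ℤ, ‖c n‖ₑ ^ 2 := by
  have hsum : Summable fun n : ℤ ↦ c n • (fourier n : C(UnitAddCircle, ℂ)) := by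
    refine .of_norm ?_
    simpa [norm_smul, fourier_norm] using hc.norm
  set F : C(UnitAddCircle, ℂ) := ∑' n : ℤ, c n • fourier n
  have hFx (x : ℝ) : F x = ∑' n : ℤ, c n * cexp (2 * Real.pi * I * n * x) := by
    have h := (ContinuousMap.evalCLM ℂ (x : UnitAddCircle)).hasSum hsum.hasSum
    simpa [fourier_coe_apply] using h.tsum_eq.symm
  set G := ContinuousMap.toLp (E := ℂ) 2 (AddCircle.haarAddCircle (T := 1)) ℂ F
  have hGsum : HasSum (fun n : ℤ ↦ c n • fourierLp (T := 1) 2 n) G := by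
    simpa using (ContinuousMap.toLp (E := ℂ) 2
      (AddCircle.haarAddCircle (T := 1)) ℂ).hasSum hsum.hasSum
  have hcoeff (m : ℤ) : fourierCoeff G m = c m := by
    rw [← fourierBasis_repr, HilbertBasis.repr_apply_apply, coe_fourierBasis]
    have h := (innerSL ℂ (fourierLp (T := 1) 2 m)).hasSum hGsum
    have h' := hasSum_single (f := fun n ↦ innerSL ℂ (fourierLp (T := 1) 2 m)
      (c n • fourierLp (T := 1) 2 n)) m (fun n hn ↦ by
        simp [(orthonormal_fourier (T := 1)).2 hn.symm])
    refine (h.unique h').trans ?_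
    simp [inner_self_eq_norm_sq_to_K, (orthonormal_fourier (T := 1)).1 m]
  have hP := hasSum_sq_fourierCoeff G
  simp only [hcoeff] at hP
  have hint : ∫ t : UnitAddCircle, ‖G t‖ ^ 2 ∂AddCircle.haarAddCircle =
      ∫ t : UnitAddCircle, ‖F t‖ ^ 2 ∂AddCircle.haarAddCircle := by
    refine integral_congr_ae ?_
    filter_upwards [ContinuousMap.coeFn_toLp (p := 2) (𝕜 := ℂ)
      (AddCircle.haarAddCircle (T := 1)) F] with t ht
    rw [ht]
  rw [hint, AddCircle.integral_haarAddCircle, inv_one, one_smul] at hP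
  have hFint : Integrable (fun t ↦ ‖F t‖ ^ 2) (volume : Measure UnitAddCircle) :=
    (by fun_prop : Continuous fun t ↦ ‖F t‖ ^ 2).integrable_of_hasCompactSupport
      (HasCompactSupport.of_compactSpace _)
  have henorm (w : ℂ) : ENNReal.ofReal (‖w‖ ^ 2) = ‖w‖ₑ ^ 2 := by
    rw [ENNReal.ofReal_pow (norm_nonneg _), ofReal_norm]
  calc ∫⁻ x in Set.Icc (0 : ℝ) 1, ‖∑' n : ℤ, c n * cexp (2 * Real.pi * I * n * x)‖ₑ ^ 2
      = ∫⁻ x in Set.Ioc (0 : ℝ) (0 + 1), ‖F x‖ₑ ^ 2 := by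
        simp only [hFx, zero_add]
        exact setLIntegral_congr Ioc_ae_eq_Icc.symm
    _ = ∫⁻ t : UnitAddCircle, ‖F t‖ₑ ^ 2 :=
        UnitAddCircle.lintegral_preimage 0 fun t ↦ ‖F t‖ₑ ^ 2
    _ = ENNReal.ofReal (∫ t : UnitAddCircle, ‖F t‖ ^ 2) := by
        rw [ofReal_integral_eq_lintegral_ofReal hFint (.of_forall fun _ ↦ by positivity)]
        simp only [henorm]
    _ = ∑' n : ℤ, ‖c n‖ₑ ^ 2 := by
        rw [← hP.tsum_eq, ENNReal.ofReal_tsum_of_nonneg (fun _ ↦ by positivity) hP.summable]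
        simp only [henorm]

/-- The terms of the theta series with characteristic are, up to a common factor, the terms of
the two-variable Jacobi theta series. -/
theorem cexp_theta_term_eq (α β : ℝ) (z τ : ℂ) (n : ℤ) :
    cexp (Real.pi * I * ((n : ℂ) + α) ^ 2 * τ + 2 * Real.pi * I * ((n : ℂ) + α) * (z + β)) =
      cexp (Real.pi * I * α ^ 2 * τ + 2 * Real.pi * I * α * (z + β)) *
        jacobiTheta₂_term n (z + β + α * τ) τ := by
  rw [jacobiTheta₂_term, ← Complex.exp_add]
  congr 1
  ring

theorem riemannTheta_eq_jacobiTheta₂ (α β : ℝ) (z τ : ℂ) :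
    riemannTheta α β z τ = cexp (Real.pi * I * α ^ 2 * τ + 2 * Real.pi * I * α * (z + β)) *
      jacobiTheta₂ (z + β + α * τ) τ := by
  simp only [riemannTheta, cexp_theta_term_eq, tsum_mul_left, jacobiTheta₂]

theorem continuous_riemannTheta (α β : ℝ) {τ : ℂ} (hτ : 0 < τ.im) :
    Continuous fun z ↦ riemannTheta α β z τ := by
  have hJ : Continuous fun z ↦ jacobiTheta₂ z τ := continuous_iff_continuousAt.2 fun z ↦
    (differentiableAt_jacobiTheta₂_fst z hτ).continuousAt
  simp only [riemannTheta_eq_jacobiTheta₂]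
  fun_prop

theorem summable_cexp_theta_term (α β : ℝ) (z : ℂ) {τ : ℂ} (hτ : 0 < τ.im) :
    Summable fun n : ℤ ↦ cexp (Real.pi * I * ((n : ℂ) + α) ^ 2 * τ +
      2 * Real.pi * I * ((n : ℂ) + α) * (z + β)) := by
  simp only [cexp_theta_term_eq]
  exact (hasSum_jacobiTheta₂_term _ hτ).summable.mul_left _

/-- The `L²` norm of the theta function over a horizontal period. -/
theorem lintegral_enorm_sq_riemannTheta (α β y : ℝ) {τ : ℂ} (hτ : 0 < τ.im) :
    ∫⁻ x in Set.Icc (0 : ℝ) 1, ‖riemannTheta α β (x + y * I) τ‖ₑ ^ 2 =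
      ∑' n : ℤ, ENNReal.ofReal
        (Real.exp (-2 * Real.pi * (n + α) ^ 2 * τ.im - 4 * Real.pi * (n + α) * y)) := by
  have hc := summable_cexp_theta_term α β (y * I) hτ
  have hshift (x : ℝ) : ‖riemannTheta α β (x + y * I) τ‖ₑ =
      ‖∑' n : ℤ, cexp (Real.pi * I * ((n : ℂ) + α) ^ 2 * τ +
        2 * Real.pi * I * ((n : ℂ) + α) * (y * I + β)) * cexp (2 * Real.pi * I * n * x)‖ₑ := by
    have hterm (n : ℤ) : cexp (Real.pi * I * ((n : ℂ) + α) ^ 2 * τ +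
        2 * Real.pi * I * ((n : ℂ) + α) * (x + y * I + β)) =
        cexp ((2 * Real.pi * α * x : ℝ) * I) * (cexp (Real.pi * I * ((n : ℂ) + α) ^ 2 * τ +
          2 * Real.pi * I * ((n : ℂ) + α) * (y * I + β)) * cexp (2 * Real.pi * I * n * x)) := by
      rw [← Complex.exp_add, ← Complex.exp_add]
      congr 1
      push_cast
      ring
    have hone : ‖cexp ((2 * Real.pi * α * x : ℝ) * I)‖ₑ = 1 := by
      rw [← ofReal_norm, Complex.norm_exp_ofReal_mul_I, ENNReal.ofReal_one]
    simp only [riemannTheta, hterm, tsum_mul_left]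
    rw [enorm_mul, hone, one_mul]
  simp only [hshift]
  rw [lintegral_enorm_sq_tsum_fourier hc]
  refine tsum_congr fun n ↦ ?_
  rw [← ofReal_norm, ← ENNReal.ofReal_pow (norm_nonneg _), Complex.norm_exp, ← Real.exp_nat_mul]
  congr 2
  simp [pow_two]
  ring

/-- The Gaussian integral with a linear term in the exponent. -/
theorem lintegral_exp_neg_mul_sq_add_mul {b : ℝ} (hb : 0 < b) (a k : ℝ) :
    ∫⁻ y : ℝ, ENNReal.ofReal (Real.exp (-b * y ^ 2 + a * y + k)) =
      ENNReal.ofReal (√(Real.pi / b)) * ENNReal.ofReal (Real.exp (a ^ 2 / (4 * b) + k)) := by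
  have hsq (y : ℝ) : ENNReal.ofReal (Real.exp (-b * y ^ 2 + a * y + k)) =
      ENNReal.ofReal (Real.exp (-b * (y - a / (2 * b)) ^ 2)) *
        ENNReal.ofReal (Real.exp (a ^ 2 / (4 * b) + k)) := by
    rw [← ENNReal.ofReal_mul (Real.exp_nonneg _), ← Real.exp_add]
    congr 2
    field_simp
    ring
  simp only [hsq]
  rw [lintegral_mul_const _ (by fun_prop),
    lintegral_sub_right_eq_self (fun y ↦ ENNReal.ofReal (Real.exp (-b * y ^ 2))),
    ← ofReal_integral_eq_lintegral_ofReal (integrable_exp_neg_mul_sq hb)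
      (.of_forall fun _ ↦ Real.exp_nonneg _), integral_gaussian]

/-- Tonelli's theorem on a vertical strip. -/
theorem setLIntegral_re_preimage {s : Set ℝ} (hs : MeasurableSet s) {g : ℂ → ℝ≥0∞}
    (hg : Measurable g) :
    ∫⁻ z in {z : ℂ | z.re ∈ s}, g z = ∫⁻ y : ℝ, ∫⁻ x in s, g (x + y * I) := by
  have hpre : {z : ℂ | z.re ∈ s} = measurableEquivRealProd ⁻¹' (s ×ˢ Set.univ) := by
    ext z
    simp
  have hcomp (z : ℂ) : g z = (fun p : ℝ × ℝ ↦ g (p.1 + p.2 * I)) (measurableEquivRealProd z) := by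
    simp [re_add_im]
  have hg' : Measurable fun p : ℝ × ℝ ↦ g (p.1 + p.2 * I) := by fun_prop
  simp only [hpre]
  rw [setLIntegral_congr_fun (measurableEquivRealProd.measurable (hs.prod .univ))
      fun z _ ↦ hcomp z,
    volume_preserving_equiv_real_prod.setLIntegral_comp_preimage (hs.prod .univ) hg',
    Measure.volume_eq_prod, ← Measure.prod_restrict, Measure.restrict_univ,
    lintegral_prod_symm _ hg'.aemeasurable]

/-- A shifted Gaussian series over the integers converges exactly for negative exponents. -/
theorem tsum_ofReal_exp_shifted_sq_ne_top_iff (α s : ℝ) :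
    ∑' n : ℤ, ENNReal.ofReal (Real.exp (-2 * Real.pi * (n + α) ^ 2 * s)) ≠ ⊤ ↔ 0 < s := by
  constructor
  · intro h
    by_contra! hs
    refine h (top_unique ?_)
    calc (⊤ : ℝ≥0∞) = ∑' _ : ℤ, (1 : ℝ≥0∞) := (ENNReal.tsum_const_eq_top_of_ne_zero one_ne_zero).symm
      _ ≤ _ := ENNReal.tsum_le_tsum fun n ↦ by
        rw [ENNReal.one_le_ofReal, Real.one_le_exp_iff]
        have := mul_nonneg (mul_nonneg Real.pi_pos.le (sq_nonneg ((n : ℝ) + α))) (neg_nonneg.2 hs)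
        linarith
  · intro hs
    have hsum := (((summable_jacobiTheta₂_term_iff ((2 * s * α : ℝ) * I) ((2 * s : ℝ) * I)).2
      (by simpa using hs)).norm).mul_right (Real.exp (-2 * Real.pi * α ^ 2 * s))
    refine Summable.tsum_ofReal_ne_top (hsum.congr fun n ↦ ?_)
    rw [norm_jacobiTheta₂_term, ← Real.exp_add]
    congr 1
    simp
    ring

/-- The integrand over the strip, in Cartesian coordinates. -/
theorem enorm_sq_exp_mul_mul_exp_neg_normSq (ν x y : ℝ) (w : ℂ) :
    ‖cexp (ν / 2 * (x + y * I) ^ 2) * w‖ₑ ^ 2 *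
        ENNReal.ofReal (Real.exp (-ν * normSq (x + y * I))) =
      ENNReal.ofReal (Real.exp (-(2 * ν) * y ^ 2)) * ‖w‖ₑ ^ 2 := by
  rw [enorm_mul, mul_pow, mul_right_comm, ← ofReal_norm (cexp _),
    ← ENNReal.ofReal_pow (norm_nonneg _), ← ENNReal.ofReal_mul (by positivity),
    Complex.norm_exp, ← Real.exp_nat_mul, ← Real.exp_add]
  have hre : ((ν : ℂ) / 2 * (x + y * I) ^ 2).re = ν / 2 * (x ^ 2 - y ^ 2) := by
    have : (ν : ℂ) / 2 * (x + y * I) ^ 2 =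
        (ν / 2 * (x ^ 2 - y ^ 2) : ℝ) + (ν * x * y : ℝ) * I := by
      push_cast
      linear_combination (ν : ℂ) / 2 * y ^ 2 * I_sq
    rw [this, add_re, ofReal_re, re_ofReal_mul, I_re, mul_zero, add_zero]
  rw [hre, normSq_add_mul_I]
  congr 3
  push_cast
  ring

/-- For `f(z) = e^{(ν/2)z²} θ_{α,β}(z|τ)` with `Im τ > 0`,
`∫_S |f(z)|² e^{−ν|z|²} dm(z) = (π/(2ν))^{1/2} Σ_{n∈ℤ} e^{−2π(n+α)²(Im τ − π/ν)}`
as an identity in `[0,∞]`; in particular the integral is finite iff `Im τ > π/ν`. -/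
theorem stmt_9 (α ν β : ℝ) (hν : 0 < ν) (τ : ℂ) (hτ : 0 < τ.im)
    (f : ℂ → ℂ) (hf : ∀ z : ℂ, f z = Complex.exp (ν / 2 * z ^ 2) * riemannTheta α β z τ) :
    (∫⁻ z in {z : ℂ | z.re ∈ Set.Icc (0 : ℝ) 1},
        (‖f z‖₊ : ℝ≥0∞) ^ 2 * ENNReal.ofReal (Real.exp (-ν * Complex.normSq z)))
      = ENNReal.ofReal ((Real.pi / (2 * ν)) ^ ((1 : ℝ) / 2)) *
          ∑' n : ℤ, ENNReal.ofReal
            (Real.exp (-2 * Real.pi * (n + α) ^ 2 * (τ.im - Real.pi / ν))) ∧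
    ((∫⁻ z in {z : ℂ | z.re ∈ Set.Icc (0 : ℝ) 1},
        (‖f z‖₊ : ℝ≥0∞) ^ 2 * ENNReal.ofReal (Real.exp (-ν * Complex.normSq z))) ≠ ⊤
      ↔ Real.pi / ν < τ.im) := by
  have hθ := continuous_riemannTheta α β hτ
  have hfc : Continuous f := by
    rw [funext hf]
    fun_prop
  have key : (∫⁻ z in {z : ℂ | z.re ∈ Set.Icc (0 : ℝ) 1},
        (‖f z‖₊ : ℝ≥0∞) ^ 2 * ENNReal.ofReal (Real.exp (-ν * Complex.normSq z)))
      = ENNReal.ofReal ((Real.pi / (2 * ν)) ^ ((1 : ℝ) / 2)) *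
          ∑' n : ℤ, ENNReal.ofReal
            (Real.exp (-2 * Real.pi * (n + α) ^ 2 * (τ.im - Real.pi / ν))) := by
    have hmeas : Measurable fun z : ℂ ↦
        (‖f z‖₊ : ℝ≥0∞) ^ 2 * ENNReal.ofReal (Real.exp (-ν * Complex.normSq z)) := by
      have := hfc.measurable
      have := Complex.continuous_normSq.measurable
      fun_prop
    rw [setLIntegral_re_preimage measurableSet_Icc hmeas]
    simp only [← enorm_eq_nnnorm, hf, enorm_sq_exp_mul_mul_exp_neg_normSq]
    have hinner (y : ℝ) : ∫⁻ x in Set.Icc (0 : ℝ) 1, ENNReal.ofReal (Real.exp (-(2 * ν) * y ^ 2)) *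
          ‖riemannTheta α β (x + y * I) τ‖ₑ ^ 2 =
        ∑' n : ℤ, ENNReal.ofReal (Real.exp (-(2 * ν) * y ^ 2 + -4 * Real.pi * (n + α) * y +
          -2 * Real.pi * (n + α) ^ 2 * τ.im)) := by
      rw [lintegral_const_mul' _ _ ENNReal.ofReal_ne_top, lintegral_enorm_sq_riemannTheta α β y hτ,
        ← ENNReal.tsum_mul_left]
      refine tsum_congr fun n ↦ ?_
      rw [← ENNReal.ofReal_mul (Real.exp_nonneg _), ← Real.exp_add]
      congr 2
      ring
    simp only [hinner]
    rw [lintegral_tsum fun n ↦ by fun_prop, ← ENNReal.tsum_mul_left]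
    refine tsum_congr fun n ↦ ?_
    rw [lintegral_exp_neg_mul_sq_add_mul (by positivity), Real.sqrt_eq_rpow]
    congr 3
    field_simp
    ring
  refine ⟨key, ?_⟩
  have hpos : 0 < (Real.pi / (2 * ν)) ^ ((1 : ℝ) / 2) := by positivity
  rw [key, ← sub_pos, ← tsum_ofReal_exp_shifted_sq_ne_top_iff α, not_iff_not]
  simp only [ENNReal.mul_eq_top, ENNReal.ofReal_ne_top, false_and, or_false, ne_eq,
    ENNReal.ofReal_eq_zero, hpos.not_ge, not_false_eq_true, true_and]
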